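/- arXiv:2503.23296 — 2 statements merged into one kernel-verified Lean document; each statement's English description precedes it below -/
import Mathlib

section
/- Unconditional discrete energy dissipation of the fully implicit RMAC scheme for the Navier–Stokes equations on a uniform grid: if the source term g ≡ 0 (all discrete right-hand sides vanish), then the discrete solution satisfies, for every n ≥ 1 and every Δt > 0, ‖W^n‖²_{l2} − ‖W^{n−1}‖²_{l2} ≤ −Δt·μ·‖DW^n‖²_{l2} ≤ 0. -/
open Finset MeasureTheory Real

noncomputable section

namespace RMAC

/-! ### Continuous-level notions -/

/-- Partial derivative in the first (x) variable of a function of (x, y, t). -/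
def pdx (f : ℝ → ℝ → ℝ → ℝ) : ℝ → ℝ → ℝ → ℝ := fun x y t => deriv (fun s => f s y t) x

/-- Partial derivative in the second (y) variable. -/
def pdy (f : ℝ → ℝ → ℝ → ℝ) : ℝ → ℝ → ℝ → ℝ := fun x y t => deriv (fun s => f x s t) y

/-- Partial derivative in the third (t) variable. -/
def pdt (f : ℝ → ℝ → ℝ → ℝ) : ℝ → ℝ → ℝ → ℝ := fun x y t => deriv (fun s => f x y s) t

/-- Infinitely differentiable function of (x, y, t). -/
def Smooth (f : ℝ → ℝ → ℝ → ℝ) : Prop :=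
  ∀ n : ℕ, ContDiff ℝ n (fun q : ℝ × ℝ × ℝ => f q.1 q.2.1 q.2.2)

/-- `SobBound a b f Lx Ly T M` : all derivatives `∂_t^{a'} ∂_x^{b'} ∂_y^{c'} f` with `a' ≤ a`,
`b' + c' ≤ b` are bounded by `M` on `[0,Lx] × [0,Ly] × [0,T]`; this encodes
`‖f‖_{W^{a,∞}([0,T];W^{b,∞}(Ω))} ≤ M`. -/
def SobBound (a b : ℕ) (f : ℝ → ℝ → ℝ → ℝ) (Lx Ly T M : ℝ) : Prop :=
  ∀ a' b' c' : ℕ, a' ≤ a → b' + c' ≤ b →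
    ∀ x y t : ℝ, x ∈ Set.Icc 0 Lx → y ∈ Set.Icc 0 Ly → t ∈ Set.Icc 0 T →
      |(pdt^[a'] (pdx^[b'] (pdy^[c'] f))) x y t| ≤ M

/-- The time-dependent Stokes problem on `Ω = (0,Lx) × (0,Ly)`, `t ∈ (0,T]`, with
viscosity `μ`, source `(gx, gy)`, homogeneous Dirichlet boundary condition and
homogeneous initial condition. -/
def IsStokesSol (μ Lx Ly T : ℝ) (ux uy p gx gy : ℝ → ℝ → ℝ → ℝ) : Prop :=
  (∀ x y t : ℝ, x ∈ Set.Ioo 0 Lx → y ∈ Set.Ioo 0 Ly → t ∈ Set.Ioc 0 T →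
      pdt ux x y t - μ * (pdx (pdx ux) x y t + pdy (pdy ux) x y t) + pdx p x y t = gx x y t ∧
      pdt uy x y t - μ * (pdx (pdx uy) x y t + pdy (pdy uy) x y t) + pdy p x y t = gy x y t ∧
      pdx ux x y t + pdy uy x y t = 0) ∧
  (∀ x y t : ℝ, x ∈ Set.Icc 0 Lx → y ∈ Set.Icc 0 Ly → t ∈ Set.Ioc 0 T →
      (x = 0 ∨ x = Lx ∨ y = 0 ∨ y = Ly) → ux x y t = 0 ∧ uy x y t = 0) ∧
  (∀ x y : ℝ, x ∈ Set.Icc 0 Lx → y ∈ Set.Icc 0 Ly → ux x y 0 = 0 ∧ uy x y 0 = 0)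

/-- Divergence-free velocity field on `Ω` for all times in `[0,T]`. -/
def DivFree (Lx Ly T : ℝ) (ux uy : ℝ → ℝ → ℝ → ℝ) : Prop :=
  ∀ x y t : ℝ, x ∈ Set.Ioo 0 Lx → y ∈ Set.Ioo 0 Ly → t ∈ Set.Icc 0 T →
    pdx ux x y t + pdy uy x y t = 0

/-- Homogeneous velocity boundary values on `∂Ω` for all times in `[0,T]`. -/
def BoundaryZero (Lx Ly T : ℝ) (ux uy : ℝ → ℝ → ℝ → ℝ) : Prop :=
  ∀ x y t : ℝ, x ∈ Set.Icc 0 Lx → y ∈ Set.Icc 0 Ly → t ∈ Set.Icc 0 T →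
    (x = 0 ∨ x = Lx ∨ y = 0 ∨ y = Ly) → ux x y t = 0 ∧ uy x y t = 0

/-! ### The staggered (MAC) grid

Index conventions for grid functions `f : ℤ → ℤ → ℝ`:
* cell-centered functions: `f i j` is the value at `(x_{i+1/2}, y_{j+1/2})`;
* x-edge functions (like `u^x`): `f i j` is the value at `(x_i, y_{j+1/2})`,
  with `j = -1` and `j = Ny` the ghost values representing `(x_i, y_0)` and `(x_i, y_{Ny})`;
* y-edge functions (like `u^y`): `f i j` is the value at `(x_{i+1/2}, y_j)`,
  with `i = -1` and `i = Nx` the ghost values representing `(x_0, y_j)` and `(x_{Nx}, y_j)`;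
* node functions: `f i j` is the value at `(x_i, y_j)`. -/
structure Grid where
  Nx : ℕ
  Ny : ℕ
  Lx : ℝ
  Ly : ℝ
  xp : ℤ → ℝ
  yp : ℤ → ℝ
  one_le_Nx : 1 ≤ Nx
  one_le_Ny : 1 ≤ Ny
  xp_zero : xp 0 = 0
  xp_last : xp Nx = Lx
  yp_zero : yp 0 = 0
  yp_last : yp Ny = Ly
  xp_mono : ∀ i : ℤ, 0 ≤ i → i < Nx → xp i < xp (i + 1)
  yp_mono : ∀ j : ℤ, 0 ≤ j → j < Ny → yp j < yp (j + 1)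

namespace Grid

variable (G : Grid)

/-- `h_{i+1/2} = x_{i+1} - x_i`. -/
def hh (i : ℤ) : ℝ := G.xp (i + 1) - G.xp i

/-- `k_{j+1/2} = y_{j+1} - y_j`. -/
def kk (j : ℤ) : ℝ := G.yp (j + 1) - G.yp j

/-- `x_{i+1/2} = (x_i + x_{i+1})/2`. -/
def xh (i : ℤ) : ℝ := (G.xp i + G.xp (i + 1)) / 2

/-- `y_{j+1/2} = (y_j + y_{j+1})/2`. -/
def yh (j : ℤ) : ℝ := (G.yp j + G.yp (j + 1)) / 2

/-- `h_i = (h_{i-1/2} + h_{i+1/2})/2`, with `h_0 = h_{1/2}/2`, `h_{Nx} = h_{Nx-1/2}/2`. -/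
def hc (i : ℤ) : ℝ :=
  if i = 0 then G.hh 0 / 2
  else if i = (G.Nx : ℤ) then G.hh ((G.Nx : ℤ) - 1) / 2
  else (G.hh (i - 1) + G.hh i) / 2

/-- `k_j = (k_{j-1/2} + k_{j+1/2})/2`, with `k_0 = k_{1/2}/2`, `k_{Ny} = k_{Ny-1/2}/2`. -/
def kc (j : ℤ) : ℝ :=
  if j = 0 then G.kk 0 / 2
  else if j = (G.Ny : ℤ) then G.kk ((G.Ny : ℤ) - 1) / 2
  else (G.kk (j - 1) + G.kk j) / 2

/-- `h = max_i h_{i+1/2}`. -/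
def hmax : ℝ :=
  (Finset.Icc (0 : ℤ) ((G.Nx : ℤ) - 1)).sup'
    (Finset.nonempty_Icc.mpr (by have := G.one_le_Nx; omega)) G.hh

/-- `k = max_j k_{j+1/2}`. -/
def kmax : ℝ :=
  (Finset.Icc (0 : ℤ) ((G.Ny : ℤ) - 1)).sup'
    (Finset.nonempty_Icc.mpr (by have := G.one_le_Ny; omega)) G.kk

/-- Mesh regularity: `min_{i,j} {h_{i+1/2}, k_{j+1/2}} ≥ C₀ · max_{i,j} {h_{i+1/2}, k_{j+1/2}}`. -/
def Regular (C₀ : ℝ) : Prop :=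
  (∀ i : ℤ, 0 ≤ i → i < G.Nx → C₀ * G.hmax ≤ G.hh i ∧ C₀ * G.kmax ≤ G.hh i) ∧
  (∀ j : ℤ, 0 ≤ j → j < G.Ny → C₀ * G.hmax ≤ G.kk j ∧ C₀ * G.kmax ≤ G.kk j)

/-! ### Difference operators -/

/-- `d_x` of an x-edge function: value at the cell center `(x_{i+1/2}, y_{j+1/2})`. -/
def dxEx (f : ℤ → ℤ → ℝ) (i j : ℤ) : ℝ := (f (i + 1) j - f i j) / G.hh i

/-- `D_y` of an x-edge function: value at the node `(x_i, y_j)`. -/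
def DyEx (f : ℤ → ℤ → ℝ) (i j : ℤ) : ℝ := (f i j - f i (j - 1)) / G.kc j

/-- `d_y` of a y-edge function: value at the cell center `(x_{i+1/2}, y_{j+1/2})`. -/
def dyEy (f : ℤ → ℤ → ℝ) (i j : ℤ) : ℝ := (f i (j + 1) - f i j) / G.kk j

/-- `D_x` of a y-edge function: value at the node `(x_i, y_j)`. -/
def DxEy (f : ℤ → ℤ → ℝ) (i j : ℤ) : ℝ := (f i j - f (i - 1) j) / G.hc i

/-- `D_x` of a cell-centered function: value at the x-edge point `(x_i, y_{j+1/2})`. -/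
def DxC (q : ℤ → ℤ → ℝ) (i j : ℤ) : ℝ := (q i j - q (i - 1) j) / G.hc i

/-- `D_y` of a cell-centered function: value at the y-edge point `(x_{i+1/2}, y_j)`. -/
def DyC (q : ℤ → ℤ → ℝ) (i j : ℤ) : ℝ := (q i j - q i (j - 1)) / G.kc j

/-! ### Discrete inner products and norms -/

/-- `(f,g)_{l²,M}` over cell centers. -/
def ipM (f g : ℤ → ℤ → ℝ) : ℝ :=
  ∑ i ∈ Finset.Icc (0 : ℤ) ((G.Nx : ℤ) - 1), ∑ j ∈ Finset.Icc (0 : ℤ) ((G.Ny : ℤ) - 1),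
    G.hh i * G.kk j * f i j * g i j

/-- `(f,g)_{l²,T,M}` over x-edge points. -/
def ipTM (f g : ℤ → ℤ → ℝ) : ℝ :=
  ∑ i ∈ Finset.Icc (1 : ℤ) ((G.Nx : ℤ) - 1), ∑ j ∈ Finset.Icc (0 : ℤ) ((G.Ny : ℤ) - 1),
    G.hc i * G.kk j * f i j * g i j

/-- `(f,g)_{l²,M,T}` over y-edge points. -/
def ipMT (f g : ℤ → ℤ → ℝ) : ℝ :=
  ∑ i ∈ Finset.Icc (0 : ℤ) ((G.Nx : ℤ) - 1), ∑ j ∈ Finset.Icc (1 : ℤ) ((G.Ny : ℤ) - 1),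
    G.hh i * G.kc j * f i j * g i j

/-- `(f,g)_{l²,T_x}`. -/
def ipTx (f g : ℤ → ℤ → ℝ) : ℝ :=
  ∑ i ∈ Finset.Icc (0 : ℤ) (G.Nx : ℤ), ∑ j ∈ Finset.Icc (1 : ℤ) ((G.Ny : ℤ) - 1),
    G.hc i * G.kc j * f i j * g i j

/-- `(f,g)_{l²,T_y}`. -/
def ipTy (f g : ℤ → ℤ → ℝ) : ℝ :=
  ∑ i ∈ Finset.Icc (1 : ℤ) ((G.Nx : ℤ) - 1), ∑ j ∈ Finset.Icc (0 : ℤ) (G.Ny : ℤ),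
    G.hc i * G.kc j * f i j * g i j

/-- `‖v‖²_{l²} = ‖v^x‖²_{l²,T,M} + ‖v^y‖²_{l²,M,T}` for a discrete velocity. -/
def velNormSq (vx vy : ℤ → ℤ → ℝ) : ℝ := G.ipTM vx vx + G.ipMT vy vy

/-- `‖Dv‖²_{l²}` for a discrete velocity. -/
def DvelNormSq (vx vy : ℤ → ℤ → ℝ) : ℝ :=
  G.ipM (G.dxEx vx) (G.dxEx vx) + G.ipTy (G.DyEx vx) (G.DyEx vx) +
    G.ipTx (G.DxEy vy) (G.DxEy vy) + G.ipM (G.dyEy vy) (G.dyEy vy)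

/-! ### Right-hand side discretization and the RMAC scheme -/

/-- `f^{x,n}_{i,j+1/2} = (1/h_i) ∫_{x_{i-1/2}}^{x_{i+1/2}} g^x(x, y_{j+1/2}, t^n) dx`. -/
def avgFx (gx : ℝ → ℝ → ℝ → ℝ) (Δt : ℝ) : ℕ → ℤ → ℤ → ℝ := fun n i j =>
  (1 / G.hc i) * ∫ x in (G.xh (i - 1))..(G.xh i), gx x (G.yh j) ((n : ℝ) * Δt)

/-- `f^{y,n}_{i+1/2,j} = (1/k_j) ∫_{y_{j-1/2}}^{y_{j+1/2}} g^y(x_{i+1/2}, y, t^n) dy`. -/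
def avgFy (gy : ℝ → ℝ → ℝ → ℝ) (Δt : ℝ) : ℕ → ℤ → ℤ → ℝ := fun n i j =>
  (1 / G.kc j) * ∫ y in (G.yh (j - 1))..(G.yh j), gy (G.xh i) y ((n : ℝ) * Δt)

/-- The RMAC scheme for the time-dependent Stokes equations, with discrete right-hand
sides `fx`, `fy`: homogeneous discrete boundary and initial conditions, the two discrete
momentum equations and the discrete divergence-free constraint. -/
def IsRMAC (μ Δt : ℝ) (fx fy Wx Wy Z : ℕ → ℤ → ℤ → ℝ) : Prop :=
  (∀ n : ℕ, ∀ j : ℤ, Wx n 0 j = 0 ∧ Wx n (G.Nx : ℤ) j = 0) ∧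
  (∀ n : ℕ, ∀ i : ℤ, Wx n i (-1) = 0 ∧ Wx n i (G.Ny : ℤ) = 0) ∧
  (∀ n : ℕ, ∀ i : ℤ, Wy n i 0 = 0 ∧ Wy n i (G.Ny : ℤ) = 0) ∧
  (∀ n : ℕ, ∀ j : ℤ, Wy n (-1) j = 0 ∧ Wy n (G.Nx : ℤ) j = 0) ∧
  (∀ i j : ℤ, Wx 0 i j = 0 ∧ Wy 0 i j = 0) ∧
  (∀ n : ℕ, 1 ≤ n →
    ∀ i ∈ Finset.Icc (1 : ℤ) ((G.Nx : ℤ) - 1), ∀ j ∈ Finset.Icc (0 : ℤ) ((G.Ny : ℤ) - 1),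
      (Wx n i j - Wx (n - 1) i j) / Δt
        - μ * ((G.dxEx (Wx n) i j - G.dxEx (Wx n) (i - 1) j) / G.hc i)
        - μ * ((G.DyEx (Wx n) i (j + 1) - G.DyEx (Wx n) i j) / G.kk j)
        + G.DxC (Z n) i j = fx n i j) ∧
  (∀ n : ℕ, 1 ≤ n →
    ∀ i ∈ Finset.Icc (0 : ℤ) ((G.Nx : ℤ) - 1), ∀ j ∈ Finset.Icc (1 : ℤ) ((G.Ny : ℤ) - 1),
      (Wy n i j - Wy (n - 1) i j) / Δt
        - μ * ((G.DxEy (Wy n) (i + 1) j - G.DxEy (Wy n) i j) / G.hh i)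
        - μ * ((G.dyEy (Wy n) i j - G.dyEy (Wy n) i (j - 1)) / G.kc j)
        + G.DyC (Z n) i j = fy n i j) ∧
  (∀ n : ℕ, 1 ≤ n →
    ∀ i ∈ Finset.Icc (0 : ℤ) ((G.Nx : ℤ) - 1), ∀ j ∈ Finset.Icc (0 : ℤ) ((G.Ny : ℤ) - 1),
      G.dxEx (Wx n) i j + G.dyEy (Wy n) i j = 0)

/-- The compact-support condition: the discrete solution vanishes within one mesh
layer of `∂Ω`. -/
def CompactSupp (Wx Wy Z : ℕ → ℤ → ℤ → ℝ) : Prop :=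
  (∀ n : ℕ, ∀ j : ℤ,
    Wx n 0 j = 0 ∧ Wx n 1 j = 0 ∧ Wx n ((G.Nx : ℤ) - 1) j = 0 ∧ Wx n (G.Nx : ℤ) j = 0) ∧
  (∀ n : ℕ, ∀ i : ℤ,
    Wx n i (-1) = 0 ∧ Wx n i 0 = 0 ∧ Wx n i ((G.Ny : ℤ) - 1) = 0 ∧ Wx n i (G.Ny : ℤ) = 0) ∧
  (∀ n : ℕ, ∀ j : ℤ,
    Wy n (-1) j = 0 ∧ Wy n 0 j = 0 ∧ Wy n ((G.Nx : ℤ) - 1) j = 0 ∧ Wy n (G.Nx : ℤ) j = 0) ∧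
  (∀ n : ℕ, ∀ i : ℤ,
    Wy n i 0 = 0 ∧ Wy n i 1 = 0 ∧ Wy n i ((G.Ny : ℤ) - 1) = 0 ∧ Wy n i (G.Ny : ℤ) = 0) ∧
  (∀ n : ℕ, ∀ j : ℤ, Z n 0 j = 0) ∧
  (∀ n : ℕ, ∀ i : ℤ, Z n i 0 = 0)

/-! ### Auxiliary interpolants and consistency functions -/

/-- The auxiliary interpolant `ũ^{x,n}_{i,j+1/2}`, with its boundary extension. -/
def tux (ux : ℝ → ℝ → ℝ → ℝ) (Δt : ℝ) (n : ℕ) (i j : ℤ) : ℝ :=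
  if j = -1 then ux (G.xp i) (G.yp 0) ((n : ℝ) * Δt)
  else if j = (G.Ny : ℤ) then ux (G.xp i) (G.yp (G.Ny : ℤ)) ((n : ℝ) * Δt)
  else (1 / G.kk j) * (∫ y in (G.yp j)..(G.yp (j + 1)), ux (G.xp i) y ((n : ℝ) * Δt))
    - (G.kk j) ^ 2 / 6 * pdy (pdy ux) (G.xp i) (G.yh j) ((n : ℝ) * Δt)

/-- The auxiliary interpolant `ũ^{y,n}_{i+1/2,j}`, with its boundary extension. -/
def tuy (uy : ℝ → ℝ → ℝ → ℝ) (Δt : ℝ) (n : ℕ) (i j : ℤ) : ℝ :=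
  if i = -1 then uy (G.xp 0) (G.yp j) ((n : ℝ) * Δt)
  else if i = (G.Nx : ℤ) then uy (G.xp (G.Nx : ℤ)) (G.yp j) ((n : ℝ) * Δt)
  else (1 / G.hh i) * (∫ x in (G.xp i)..(G.xp (i + 1)), uy x (G.yp j) ((n : ℝ) * Δt))
    - (G.hh i) ^ 2 / 6 * pdx (pdx uy) (G.xh i) (G.yp j) ((n : ℝ) * Δt)

/-- `γ^{x,n}_{i+1/2,j+1/2} = (h_{i+1/2}²/8) ∂²u^x/∂t∂x (x_{i+1/2}, y_{j+1/2}, t^n)`. -/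
def gammax (ux : ℝ → ℝ → ℝ → ℝ) (Δt : ℝ) (n : ℕ) (i j : ℤ) : ℝ :=
  (G.hh i) ^ 2 / 8 * pdt (pdx ux) (G.xh i) (G.yh j) ((n : ℝ) * Δt)

/-- `γ^{y,n}_{i+1/2,j+1/2} = (k_{j+1/2}²/8) ∂²u^y/∂t∂y (x_{i+1/2}, y_{j+1/2}, t^n)`. -/
def gammay (uy : ℝ → ℝ → ℝ → ℝ) (Δt : ℝ) (n : ℕ) (i j : ℤ) : ℝ :=
  (G.kk j) ^ 2 / 8 * pdt (pdy uy) (G.xh i) (G.yh j) ((n : ℝ) * Δt)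

end Grid

/-! ### Averaging (interpolation) operators on a uniform grid -/

/-- `P^x_h` : x-edge function → cell-centered function. -/
def PxEx (f : ℤ → ℤ → ℝ) (i j : ℤ) : ℝ := (f i j + f (i + 1) j) / 2

/-- `P^x_h` : cell-centered function → x-edge function. -/
def PxC (q : ℤ → ℤ → ℝ) (i j : ℤ) : ℝ := (q (i - 1) j + q i j) / 2

/-- `P^x_h` : y-edge function → node function. -/
def PxEyN (f : ℤ → ℤ → ℝ) (i j : ℤ) : ℝ := (f (i - 1) j + f i j) / 2

/-- `P^x_h` : node function → y-edge function. -/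
def PxN (g : ℤ → ℤ → ℝ) (i j : ℤ) : ℝ := (g i j + g (i + 1) j) / 2

/-- `P^y_h` : y-edge function → cell-centered function. -/
def PyEy (f : ℤ → ℤ → ℝ) (i j : ℤ) : ℝ := (f i j + f i (j + 1)) / 2

/-- `P^y_h` : cell-centered function → y-edge function. -/
def PyC (q : ℤ → ℤ → ℝ) (i j : ℤ) : ℝ := (q i (j - 1) + q i j) / 2

/-- `P^y_h` : x-edge function → node function. -/
def PyEx (f : ℤ → ℤ → ℝ) (i j : ℤ) : ℝ := (f i (j - 1) + f i j) / 2

/-- `P^y_h` : node function → x-edge function. -/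
def PyN (g : ℤ → ℤ → ℝ) (i j : ℤ) : ℝ := (g i j + g i (j + 1)) / 2

namespace Grid

variable (G : Grid)

/-- The discrete nonlinear term `α^{x,n}_{i,j+1/2}` of the fully implicit RMAC scheme. -/
def alphaX (Wx Wy : ℤ → ℤ → ℝ) (i j : ℤ) : ℝ :=
  (Wx i j * G.DxC (PxEx Wx) i j
    + PxC (G.dxEx fun a b => (Wx a b) ^ 2) i j
    + PyN (fun a b => PxEyN Wy a b * G.DyEx Wx a b) i j
    + (PyEx Wx i (j + 1) * PxEyN Wy i (j + 1) - PyEx Wx i j * PxEyN Wy i j) / G.kk j) / 2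

/-- The discrete nonlinear term `α^{y,n}_{i+1/2,j}` of the fully implicit RMAC scheme. -/
def alphaY (Wx Wy : ℤ → ℤ → ℝ) (i j : ℤ) : ℝ :=
  (Wy i j * G.DyC (PyEy Wy) i j
    + PyC (G.dyEy fun a b => (Wy a b) ^ 2) i j
    + PxN (fun a b => PyEx Wx a b * G.DxEy Wy a b) i j
    + (PyEx Wx (i + 1) j * PxEyN Wy (i + 1) j - PyEx Wx i j * PxEyN Wy i j) / G.hh i) / 2

/-- The fully implicit RMAC scheme for the Navier–Stokes equations. -/
def IsRMACNS (μ Δt : ℝ) (fx fy Wx Wy Z : ℕ → ℤ → ℤ → ℝ) : Prop :=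
  (∀ n : ℕ, ∀ j : ℤ, Wx n 0 j = 0 ∧ Wx n (G.Nx : ℤ) j = 0) ∧
  (∀ n : ℕ, ∀ i : ℤ, Wx n i (-1) = 0 ∧ Wx n i (G.Ny : ℤ) = 0) ∧
  (∀ n : ℕ, ∀ i : ℤ, Wy n i 0 = 0 ∧ Wy n i (G.Ny : ℤ) = 0) ∧
  (∀ n : ℕ, ∀ j : ℤ, Wy n (-1) j = 0 ∧ Wy n (G.Nx : ℤ) j = 0) ∧
  (∀ i j : ℤ, Wx 0 i j = 0 ∧ Wy 0 i j = 0) ∧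
  (∀ n : ℕ, 1 ≤ n →
    ∀ i ∈ Finset.Icc (1 : ℤ) ((G.Nx : ℤ) - 1), ∀ j ∈ Finset.Icc (0 : ℤ) ((G.Ny : ℤ) - 1),
      (Wx n i j - Wx (n - 1) i j) / Δt
        - μ * ((G.dxEx (Wx n) i j - G.dxEx (Wx n) (i - 1) j) / G.hc i)
        - μ * ((G.DyEx (Wx n) i (j + 1) - G.DyEx (Wx n) i j) / G.kk j)
        + G.alphaX (Wx n) (Wy n) i j
        + G.DxC (Z n) i j = fx n i j) ∧
  (∀ n : ℕ, 1 ≤ n →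
    ∀ i ∈ Finset.Icc (0 : ℤ) ((G.Nx : ℤ) - 1), ∀ j ∈ Finset.Icc (1 : ℤ) ((G.Ny : ℤ) - 1),
      (Wy n i j - Wy (n - 1) i j) / Δt
        - μ * ((G.DxEy (Wy n) (i + 1) j - G.DxEy (Wy n) i j) / G.hh i)
        - μ * ((G.dyEy (Wy n) i j - G.dyEy (Wy n) i (j - 1)) / G.kc j)
        + G.alphaY (Wx n) (Wy n) i j
        + G.DyC (Z n) i j = fy n i j) ∧
  (∀ n : ℕ, 1 ≤ n →
    ∀ i ∈ Finset.Icc (0 : ℤ) ((G.Nx : ℤ) - 1), ∀ j ∈ Finset.Icc (0 : ℤ) ((G.Ny : ℤ) - 1),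
      G.dxEx (Wx n) i j + G.dyEy (Wy n) i j = 0)

/-- A uniform grid with mesh sizes `h` (in x) and `k` (in y). -/
def Uniform (h k : ℝ) : Prop :=
  (∀ i : ℤ, 0 ≤ i → i < G.Nx → G.hh i = h) ∧ (∀ j : ℤ, 0 ≤ j → j < G.Ny → G.kk j = k)

end Grid

end RMAC

namespace RMAC

/-! ### Summation over integer intervals -/

theorem sum_Icc_telescope (F : ℤ → ℝ) (a : ℤ) (m : ℕ) :
    ∑ i ∈ Finset.Icc a (a + m - 1), (F (i + 1) - F i) = F (a + m) - F a := by
  induction m with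
  | zero => simp
  | succ m ih =>
    have hset : Finset.Icc a (a + (m + 1 : ℕ) - 1) =
        insert (a + m) (Finset.Icc a (a + m - 1)) := by
      ext x
      simp only [Finset.mem_Icc, Finset.mem_insert]
      push_cast
      omega
    rw [hset, Finset.sum_insert (by simp), ih]
    push_cast
    rw [← add_assoc]
    ring

theorem sum_Icc_zero_telescope (F : ℤ → ℝ) (N : ℕ) :
    ∑ i ∈ Finset.Icc (0 : ℤ) ((N : ℤ) - 1), (F (i + 1) - F i) = F N - F 0 := by
  simpa using sum_Icc_telescope F 0 N

theorem sum_Icc_one_telescope (F : ℤ → ℝ) {N : ℕ} (hN : 1 ≤ N) :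
    ∑ i ∈ Finset.Icc (1 : ℤ) ((N : ℤ) - 1), (F (i + 1) - F i) = F N - F 1 := by
  obtain ⟨m, rfl⟩ := Nat.exists_eq_add_of_le hN
  simpa using sum_Icc_telescope F 1 m

theorem sum_Icc_zero_eq_sum_Icc_one (f : ℤ → ℝ) {N : ℕ} (hf : f 0 = 0) :
    ∑ i ∈ Finset.Icc (0 : ℤ) ((N : ℤ) - 1), f i = ∑ i ∈ Finset.Icc (1 : ℤ) ((N : ℤ) - 1), f i := by
  symm
  refine Finset.sum_subset (Finset.Icc_subset_Icc_left (by norm_num)) fun x hx hx' => ?_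
  simp only [Finset.mem_Icc] at hx hx'
  obtain rfl : x = 0 := by omega
  exact hf

theorem sum_Icc_last_eq_sum_Icc_pred (f : ℤ → ℝ) {N : ℕ} (hf : f N = 0) :
    ∑ i ∈ Finset.Icc (0 : ℤ) (N : ℤ), f i = ∑ i ∈ Finset.Icc (0 : ℤ) ((N : ℤ) - 1), f i := by
  symm
  refine Finset.sum_subset (Finset.Icc_subset_Icc_right (by omega)) fun x hx hx' => ?_
  simp only [Finset.mem_Icc] at hx hx'
  obtain rfl : x = N := by omega
  exact hf

/-- Summation by parts for an edge function `w` vanishing at both ends and a cell function `q`. -/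
theorem sum_mul_sub_edge (w q : ℤ → ℝ) {N : ℕ} (h0 : w 0 = 0) (hN : w N = 0) :
    ∑ i ∈ Finset.Icc (1 : ℤ) ((N : ℤ) - 1), w i * (q i - q (i - 1)) =
      -∑ i ∈ Finset.Icc (0 : ℤ) ((N : ℤ) - 1), (w (i + 1) - w i) * q i := by
  rw [← sum_Icc_zero_eq_sum_Icc_one (fun i => w i * (q i - q (i - 1))) (by simp [h0]),
    ← add_eq_zero_iff_eq_neg, ← Finset.sum_add_distrib]
  have h := sum_Icc_zero_telescope (fun i => w i * q (i - 1)) N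
  simp only [h0, hN, zero_mul, sub_zero] at h
  rw [← h]
  refine Finset.sum_congr rfl fun i _ => ?_
  rw [add_sub_cancel_right]
  ring

/-- Summation by parts for a cell function `w` with vanishing ghost values and an edge
function `q`. -/
theorem sum_mul_sub_cell (w q : ℤ → ℝ) {N : ℕ} (h0 : w (-1) = 0) (hN : w N = 0) :
    ∑ j ∈ Finset.Icc (0 : ℤ) ((N : ℤ) - 1), w j * (q (j + 1) - q j) =
      -∑ j ∈ Finset.Icc (0 : ℤ) (N : ℤ), (w j - w (j - 1)) * q j := by
  rw [← sum_Icc_last_eq_sum_Icc_pred (fun j => w j * (q (j + 1) - q j)) (by simp [hN]),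
    ← add_eq_zero_iff_eq_neg, ← Finset.sum_add_distrib]
  have h := sum_Icc_zero_telescope (fun j => w (j - 1) * q j) (N + 1)
  simp only [Nat.cast_add, Nat.cast_one, add_sub_cancel_right, zero_sub, h0, hN, zero_mul,
    sub_zero] at h
  rw [← h]
  exact Finset.sum_congr rfl fun j _ => by ring

/-- The discrete self-advection term in one direction is skew-symmetric. -/
theorem sum_self_advection (w : ℤ → ℝ) {N : ℕ} (hN1 : 1 ≤ N) (h0 : w 0 = 0) (hN : w N = 0) :
    ∑ i ∈ Finset.Icc (1 : ℤ) ((N : ℤ) - 1),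
      (w i ^ 2 * (w (i + 1) - w (i - 1)) + w i * (w (i + 1) ^ 2 - w (i - 1) ^ 2)) = 0 := by
  have h := sum_Icc_one_telescope
    (fun i => w (i - 1) ^ 2 * w i + w (i - 1) * w i ^ 2) hN1
  simp only [h0, hN, sub_self, add_sub_cancel_right] at h
  have hz : w ((N : ℤ) - 1) ^ 2 * 0 + w ((N : ℤ) - 1) * 0 ^ 2 - (0 ^ 2 * w 1 + 0 * w 1 ^ 2) = 0 := by
    ring
  rw [hz] at h
  rw [← h]
  exact Finset.sum_congr rfl fun i _ => by ring

/-- The discrete cross-advection term in one direction is skew-symmetric. -/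
theorem sum_cross_advection (w v : ℤ → ℝ) {N : ℕ} (h0 : v 0 = 0) (hN : v N = 0) :
    ∑ j ∈ Finset.Icc (0 : ℤ) ((N : ℤ) - 1),
      w j * (v (j + 1) * w (j + 1) - v j * w (j - 1)) = 0 := by
  have h := sum_Icc_zero_telescope (fun j => v j * w (j - 1) * w j) N
  simp only [h0, hN, zero_mul, sub_zero, add_sub_cancel_right] at h
  rw [← h]
  exact Finset.sum_congr rfl fun j _ => by ring

namespace Grid

variable {G : Grid} {h k : ℝ}

/-! ### Mesh sizes -/

theorem hh_pos {i : ℤ} (h0 : 0 ≤ i) (hN : i < G.Nx) : 0 < G.hh i :=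
  sub_pos.2 (G.xp_mono i h0 hN)

theorem kk_pos {j : ℤ} (h0 : 0 ≤ j) (hN : j < G.Ny) : 0 < G.kk j :=
  sub_pos.2 (G.yp_mono j h0 hN)

theorem hh_ne_zero {i : ℤ} (hi : i ∈ Finset.Icc (0 : ℤ) ((G.Nx : ℤ) - 1)) : G.hh i ≠ 0 := by
  rw [Finset.mem_Icc] at hi
  exact (hh_pos hi.1 (by omega)).ne'

theorem kk_ne_zero {j : ℤ} (hj : j ∈ Finset.Icc (0 : ℤ) ((G.Ny : ℤ) - 1)) : G.kk j ≠ 0 := by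
  rw [Finset.mem_Icc] at hj
  exact (kk_pos hj.1 (by omega)).ne'

theorem hc_pos {i : ℤ} (h0 : 0 ≤ i) (hN : i ≤ G.Nx) : 0 < G.hc i := by
  have := G.one_le_Nx
  unfold hc
  split_ifs with h1 h2
  · exact half_pos (hh_pos le_rfl (by omega))
  · exact half_pos (hh_pos (by omega) (by omega))
  · exact half_pos (add_pos (hh_pos (by omega) (by omega)) (hh_pos (by omega) (by omega)))

theorem kc_pos {j : ℤ} (h0 : 0 ≤ j) (hN : j ≤ G.Ny) : 0 < G.kc j := by
  have := G.one_le_Ny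
  unfold kc
  split_ifs with h1 h2
  · exact half_pos (kk_pos le_rfl (by omega))
  · exact half_pos (kk_pos (by omega) (by omega))
  · exact half_pos (add_pos (kk_pos (by omega) (by omega)) (kk_pos (by omega) (by omega)))

theorem Uniform.hc_eq (hu : G.Uniform h k) {i : ℤ} (h0 : 0 < i) (hN : i < G.Nx) : G.hc i = h := by
  rw [hc, if_neg h0.ne', if_neg hN.ne, hu.1 _ (by omega) (by omega), hu.1 _ h0.le hN]
  ring

theorem Uniform.kc_eq (hu : G.Uniform h k) {j : ℤ} (h0 : 0 < j) (hN : j < G.Ny) : G.kc j = k := by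
  rw [kc, if_neg h0.ne', if_neg hN.ne, hu.2 _ (by omega) (by omega), hu.2 _ h0.le hN]
  ring

/-! ### Positivity of the energies -/

theorem ipM_self_nonneg (f : ℤ → ℤ → ℝ) : 0 ≤ G.ipM f f := by
  refine Finset.sum_nonneg fun i hi => Finset.sum_nonneg fun j hj => ?_
  rw [Finset.mem_Icc] at hi hj
  rw [mul_assoc]
  exact mul_nonneg (mul_pos (hh_pos hi.1 (by omega)) (kk_pos hj.1 (by omega))).le
    (mul_self_nonneg _)

theorem ipTx_self_nonneg (f : ℤ → ℤ → ℝ) : 0 ≤ G.ipTx f f := by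
  refine Finset.sum_nonneg fun i hi => Finset.sum_nonneg fun j hj => ?_
  rw [Finset.mem_Icc] at hi hj
  rw [mul_assoc]
  exact mul_nonneg (mul_pos (hc_pos hi.1 hi.2) (kc_pos (by omega) (by omega))).le
    (mul_self_nonneg _)

theorem ipTy_self_nonneg (f : ℤ → ℤ → ℝ) : 0 ≤ G.ipTy f f := by
  refine Finset.sum_nonneg fun i hi => Finset.sum_nonneg fun j hj => ?_
  rw [Finset.mem_Icc] at hi hj
  rw [mul_assoc]
  exact mul_nonneg (mul_pos (hc_pos (by omega) (by omega)) (kc_pos hj.1 hj.2)).le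
    (mul_self_nonneg _)

theorem DvelNormSq_nonneg (vx vy : ℤ → ℤ → ℝ) : 0 ≤ G.DvelNormSq vx vy :=
  add_nonneg (add_nonneg (add_nonneg (ipM_self_nonneg _) (ipTy_self_nonneg _))
    (ipTx_self_nonneg _)) (ipM_self_nonneg _)

theorem ipTM_self_sub_le (v w : ℤ → ℤ → ℝ) :
    G.ipTM w w - G.ipTM v v ≤ 2 * G.ipTM (fun i j => w i j - v i j) w := by
  simp only [ipTM, Finset.mul_sum, ← Finset.sum_sub_distrib]
  refine Finset.sum_le_sum fun i hi => Finset.sum_le_sum fun j hj => ?_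
  rw [Finset.mem_Icc] at hi hj
  have hpos : 0 < G.hc i * G.kk j :=
    mul_pos (hc_pos (by omega) (by omega)) (kk_pos hj.1 (by omega))
  nlinarith [mul_nonneg hpos.le (sq_nonneg (w i j - v i j))]

theorem ipMT_self_sub_le (v w : ℤ → ℤ → ℝ) :
    G.ipMT w w - G.ipMT v v ≤ 2 * G.ipMT (fun i j => w i j - v i j) w := by
  simp only [ipMT, Finset.mul_sum, ← Finset.sum_sub_distrib]
  refine Finset.sum_le_sum fun i hi => Finset.sum_le_sum fun j hj => ?_
  rw [Finset.mem_Icc] at hi hj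
  have hpos : 0 < G.hh i * G.kc j :=
    mul_pos (hh_pos hi.1 (by omega)) (kc_pos (by omega) (by omega))
  nlinarith [mul_nonneg hpos.le (sq_nonneg (w i j - v i j))]

/-! ### Summation by parts on the grid -/

/-- Discrete gradient and divergence are adjoint in the x-direction. -/
theorem ipTM_sub_div_hc (q w : ℤ → ℤ → ℝ) (h0 : ∀ j, w 0 j = 0) (hN : ∀ j, w G.Nx j = 0) :
    G.ipTM (fun i j => (q i j - q (i - 1) j) / G.hc i) w = -G.ipM q (G.dxEx w) := by
  rw [ipTM, ipM, Finset.sum_comm, Finset.sum_comm (s := Finset.Icc (0 : ℤ) ((G.Nx : ℤ) - 1)),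
    ← Finset.sum_neg_distrib]
  refine Finset.sum_congr rfl fun j _ => ?_
  have key := congrArg (G.kk j * ·)
    (sum_mul_sub_edge (fun i => w i j) (fun i => q i j) (h0 j) (hN j))
  simp only [mul_neg, Finset.mul_sum] at key
  refine Eq.trans (Finset.sum_congr rfl fun i hi => ?_)
    (key.trans (congrArg Neg.neg (Finset.sum_congr rfl fun i hi => ?_)))
  · rw [Finset.mem_Icc] at hi
    have := (hc_pos (G := G) (i := i) (by omega) (by omega)).ne'
    field_simp
  · have := hh_ne_zero hi
    simp only [dxEx]
    field_simp

/-- Discrete gradient and divergence are adjoint in the y-direction. -/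
theorem ipMT_sub_div_kc (q w : ℤ → ℤ → ℝ) (h0 : ∀ i, w i 0 = 0) (hN : ∀ i, w i G.Ny = 0) :
    G.ipMT (fun i j => (q i j - q i (j - 1)) / G.kc j) w = -G.ipM q (G.dyEy w) := by
  rw [ipMT, ipM, ← Finset.sum_neg_distrib]
  refine Finset.sum_congr rfl fun i _ => ?_
  have key := congrArg (G.hh i * ·) (sum_mul_sub_edge (w i) (q i) (h0 i) (hN i))
  simp only [mul_neg, Finset.mul_sum] at key
  refine Eq.trans (Finset.sum_congr rfl fun j hj => ?_)
    (key.trans (congrArg Neg.neg (Finset.sum_congr rfl fun j hj => ?_)))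
  · rw [Finset.mem_Icc] at hj
    have := (kc_pos (G := G) (j := j) (by omega) (by omega)).ne'
    field_simp
  · have := kk_ne_zero hj
    simp only [dyEy]
    field_simp

theorem ipTM_sub_div_kk (q w : ℤ → ℤ → ℝ) (h0 : ∀ i, w i (-1) = 0) (hN : ∀ i, w i G.Ny = 0) :
    G.ipTM (fun i j => (q i (j + 1) - q i j) / G.kk j) w = -G.ipTy q (G.DyEx w) := by
  rw [ipTM, ipTy, ← Finset.sum_neg_distrib]
  refine Finset.sum_congr rfl fun i _ => ?_
  have key := congrArg (G.hc i * ·) (sum_mul_sub_cell (w i) (q i) (h0 i) (hN i))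
  simp only [mul_neg, Finset.mul_sum] at key
  refine Eq.trans (Finset.sum_congr rfl fun j hj => ?_)
    (key.trans (congrArg Neg.neg (Finset.sum_congr rfl fun j hj => ?_)))
  · have := kk_ne_zero hj
    field_simp
  · rw [Finset.mem_Icc] at hj
    have := (kc_pos (G := G) hj.1 hj.2).ne'
    simp only [DyEx]
    field_simp

theorem ipMT_sub_div_hh (q w : ℤ → ℤ → ℝ) (h0 : ∀ j, w (-1) j = 0) (hN : ∀ j, w G.Nx j = 0) :
    G.ipMT (fun i j => (q (i + 1) j - q i j) / G.hh i) w = -G.ipTx q (G.DxEy w) := by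
  rw [ipMT, ipTx, Finset.sum_comm, Finset.sum_comm (s := Finset.Icc (0 : ℤ) (G.Nx : ℤ)),
    ← Finset.sum_neg_distrib]
  refine Finset.sum_congr rfl fun j _ => ?_
  have key := congrArg (G.kc j * ·)
    (sum_mul_sub_cell (fun i => w i j) (fun i => q i j) (h0 j) (hN j))
  simp only [mul_neg, Finset.mul_sum] at key
  refine Eq.trans (Finset.sum_congr rfl fun i hi => ?_)
    (key.trans (congrArg Neg.neg (Finset.sum_congr rfl fun i hi => ?_)))
  · have := hh_ne_zero hi
    field_simp
  · rw [Finset.mem_Icc] at hi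
    have := (hc_pos (G := G) hi.1 hi.2).ne'
    simp only [DxEy]
    field_simp

/-! ### The nonlinear terms do no work -/

/-- A product with `D_y` of an x-edge function simplifies on a uniform grid when the other
factor vanishes on the boundary. -/
theorem Uniform.mul_DyEx (hu : G.Uniform h k) (v : ℤ → ℝ) (w : ℤ → ℤ → ℝ) (i : ℤ)
    (h0 : v 0 = 0) (hN : v G.Ny = 0) {j : ℤ} (hj0 : 0 ≤ j) (hjN : j ≤ G.Ny) :
    v j * G.DyEx w i j = v j * (w i j - w i (j - 1)) / k := by
  rcases hj0.eq_or_lt with rfl | hpos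
  · simp [h0]
  rcases hjN.eq_or_lt with rfl | hlt
  · simp [hN]
  rw [DyEx, hu.kc_eq hpos hlt, mul_div_assoc]

theorem Uniform.mul_DxEy (hu : G.Uniform h k) (v : ℤ → ℝ) (w : ℤ → ℤ → ℝ) (j : ℤ)
    (h0 : v 0 = 0) (hN : v G.Nx = 0) {i : ℤ} (hi0 : 0 ≤ i) (hiN : i ≤ G.Nx) :
    v i * G.DxEy w i j = v i * (w i j - w (i - 1) j) / h := by
  rcases hi0.eq_or_lt with rfl | hpos
  · simp [h0]
  rcases hiN.eq_or_lt with rfl | hlt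
  · simp [hN]
  rw [DxEy, hu.hc_eq hpos hlt, mul_div_assoc]

theorem Uniform.ipTM_alphaX (hu : G.Uniform h k) (hh : h ≠ 0) (hk : k ≠ 0) (Wx Wy : ℤ → ℤ → ℝ)
    (hx0 : ∀ j, Wx 0 j = 0) (hxN : ∀ j, Wx G.Nx j = 0)
    (hy0 : ∀ i, Wy i 0 = 0) (hyN : ∀ i, Wy i G.Ny = 0) :
    G.ipTM (G.alphaX Wx Wy) Wx = 0 := by
  have hself : ∑ i ∈ Finset.Icc (1 : ℤ) ((G.Nx : ℤ) - 1),
      ∑ j ∈ Finset.Icc (0 : ℤ) ((G.Ny : ℤ) - 1), k / 4 *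
        (Wx i j ^ 2 * (Wx (i + 1) j - Wx (i - 1) j)
          + Wx i j * (Wx (i + 1) j ^ 2 - Wx (i - 1) j ^ 2)) = 0 := by
    rw [Finset.sum_comm]
    refine Finset.sum_eq_zero fun j _ => ?_
    rw [← Finset.mul_sum,
      sum_self_advection (fun i => Wx i j) G.one_le_Nx (hx0 j) (hxN j), mul_zero]
  have hcross : ∑ i ∈ Finset.Icc (1 : ℤ) ((G.Nx : ℤ) - 1),
      ∑ j ∈ Finset.Icc (0 : ℤ) ((G.Ny : ℤ) - 1), h / 2 *
        (Wx i j * (PxEyN Wy i (j + 1) * Wx i (j + 1) - PxEyN Wy i j * Wx i (j - 1))) = 0 := by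
    refine Finset.sum_eq_zero fun i _ => ?_
    rw [← Finset.mul_sum, sum_cross_advection (Wx i) (PxEyN Wy i) (by simp [PxEyN, hy0])
      (by simp [PxEyN, hyN]), mul_zero]
  refine Eq.trans ?_ ((congrArg₂ (· + ·) hself hcross).trans (add_zero 0))
  simp only [ipTM, ← Finset.sum_add_distrib]
  refine Finset.sum_congr rfl fun i hi => Finset.sum_congr rfl fun j hj => ?_
  rw [Finset.mem_Icc] at hi hj
  have hv (b : ℤ) (hb0 : 0 ≤ b) (hbN : b ≤ G.Ny) :=
    hu.mul_DyEx (PxEyN Wy i) Wx i (by simp [PxEyN, hy0]) (by simp [PxEyN, hyN]) hb0 hbN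
  simp only [alphaX, PyN, hv j hj.1 (by omega), hv (j + 1) (by omega) (by omega)]
  simp only [DxC, PxC, dxEx, PxEx, PyEx, hu.hc_eq (i := i) (by omega) (by omega),
    hu.2 j hj.1 (by omega), hu.1 i (by omega) (by omega), hu.1 (i - 1) (by omega) (by omega),
    sub_add_cancel, add_sub_cancel_right]
  field_simp
  ring

theorem Uniform.ipMT_alphaY (hu : G.Uniform h k) (hh : h ≠ 0) (hk : k ≠ 0) (Wx Wy : ℤ → ℤ → ℝ)
    (hx0 : ∀ j, Wx 0 j = 0) (hxN : ∀ j, Wx G.Nx j = 0)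
    (hy0 : ∀ i, Wy i 0 = 0) (hyN : ∀ i, Wy i G.Ny = 0) :
    G.ipMT (G.alphaY Wx Wy) Wy = 0 := by
  have hself : ∑ i ∈ Finset.Icc (0 : ℤ) ((G.Nx : ℤ) - 1),
      ∑ j ∈ Finset.Icc (1 : ℤ) ((G.Ny : ℤ) - 1), h / 4 *
        (Wy i j ^ 2 * (Wy i (j + 1) - Wy i (j - 1))
          + Wy i j * (Wy i (j + 1) ^ 2 - Wy i (j - 1) ^ 2)) = 0 := by
    refine Finset.sum_eq_zero fun i _ => ?_
    rw [← Finset.mul_sum, sum_self_advection (Wy i) G.one_le_Ny (hy0 i) (hyN i), mul_zero]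
  have hcross : ∑ i ∈ Finset.Icc (0 : ℤ) ((G.Nx : ℤ) - 1),
      ∑ j ∈ Finset.Icc (1 : ℤ) ((G.Ny : ℤ) - 1), k / 2 *
        (Wy i j * (PyEx Wx (i + 1) j * Wy (i + 1) j - PyEx Wx i j * Wy (i - 1) j)) = 0 := by
    rw [Finset.sum_comm]
    refine Finset.sum_eq_zero fun j _ => ?_
    rw [← Finset.mul_sum, sum_cross_advection (fun i => Wy i j) (fun i => PyEx Wx i j)
      (by simp [PyEx, hx0]) (by simp [PyEx, hxN]), mul_zero]
  refine Eq.trans ?_ ((congrArg₂ (· + ·) hself hcross).trans (add_zero 0))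
  simp only [ipMT, ← Finset.sum_add_distrib]
  refine Finset.sum_congr rfl fun i hi => Finset.sum_congr rfl fun j hj => ?_
  rw [Finset.mem_Icc] at hi hj
  have hv (a : ℤ) (ha0 : 0 ≤ a) (haN : a ≤ G.Nx) :=
    hu.mul_DxEy (fun i => PyEx Wx i j) Wy j (by simp [PyEx, hx0]) (by simp [PyEx, hxN]) ha0 haN
  simp only [alphaY, PxN, hv i hi.1 (by omega), hv (i + 1) (by omega) (by omega)]
  simp only [DyC, PyC, dyEy, PyEy, PxEyN, hu.kc_eq (j := j) (by omega) (by omega),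
    hu.1 i hi.1 (by omega), hu.2 j (by omega) (by omega), hu.2 (j - 1) (by omega) (by omega),
    sub_add_cancel, add_sub_cancel_right]
  field_simp
  ring

end Grid

end RMAC

open RMAC

/-- unconditional discrete energy dissipation of the fully implicit RMAC
scheme for the Navier–Stokes equations on a uniform grid. With vanishing source term, for
every `n ≥ 1` and every `Δt > 0`, `‖W^n‖² − ‖W^{n-1}‖² ≤ −Δt μ ‖DW^n‖² ≤ 0`. -/
theorem rmacns_energy_dissipation (G : RMAC.Grid) (μ Δt h k : ℝ)
    (hμ : 0 < μ) (hΔt : 0 < Δt) (hh : 0 < h) (hk : 0 < k) (huni : G.Uniform h k)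
    (Wx Wy Z : ℕ → ℤ → ℤ → ℝ)
    (hW : G.IsRMACNS μ Δt (fun _ _ _ => 0) (fun _ _ _ => 0) Wx Wy Z) :
    ∀ n : ℕ, 1 ≤ n →
      G.velNormSq (Wx n) (Wy n) - G.velNormSq (Wx (n - 1)) (Wy (n - 1)) ≤
        -(Δt * μ * G.DvelNormSq (Wx n) (Wy n)) ∧
      -(Δt * μ * G.DvelNormSq (Wx n) (Wy n)) ≤ 0 := by
  intro n hn
  obtain ⟨hx, hxg, hy, hyg, -, hmx, hmy, hdiv⟩ := hW
  have hD := G.DvelNormSq_nonneg (Wx n) (Wy n)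
  have hμD : 0 ≤ Δt * μ * G.DvelNormSq (Wx n) (Wy n) := by positivity
  refine ⟨?_, neg_nonpos.2 hμD⟩
  have hpress : G.ipM (Z n) (G.dxEx (Wx n)) + G.ipM (Z n) (G.dyEy (Wy n)) = 0 := by
    simp only [Grid.ipM, ← Finset.sum_add_distrib, ← mul_add]
    exact Finset.sum_eq_zero fun i hi => Finset.sum_eq_zero fun j hj => by
      rw [hdiv n hn i hi j hj, mul_zero]
  have hmomX : G.ipTM (fun i j => Wx n i j - Wx (n - 1) i j) (Wx n) =
      Δt * (μ * G.ipTM (fun i j =>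
          (G.dxEx (Wx n) i j - G.dxEx (Wx n) (i - 1) j) / G.hc i) (Wx n)
        + μ * G.ipTM (fun i j =>
          (G.DyEx (Wx n) i (j + 1) - G.DyEx (Wx n) i j) / G.kk j) (Wx n)
        - G.ipTM (G.alphaX (Wx n) (Wy n)) (Wx n) - G.ipTM (G.DxC (Z n)) (Wx n)) := by
    simp only [Grid.ipTM, Finset.mul_sum, ← Finset.sum_add_distrib, ← Finset.sum_sub_distrib]
    refine Finset.sum_congr rfl fun i hi => Finset.sum_congr rfl fun j hj => ?_
    have hstep := (div_eq_iff hΔt.ne').1 (sub_eq_iff_eq_add.1 (sub_eq_iff_eq_add.1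
      (eq_sub_of_add_eq (eq_sub_of_add_eq (hmx n hn i hi j hj)))))
    rw [hstep]
    ring
  have hmomY : G.ipMT (fun i j => Wy n i j - Wy (n - 1) i j) (Wy n) =
      Δt * (μ * G.ipMT (fun i j =>
          (G.DxEy (Wy n) (i + 1) j - G.DxEy (Wy n) i j) / G.hh i) (Wy n)
        + μ * G.ipMT (fun i j =>
          (G.dyEy (Wy n) i j - G.dyEy (Wy n) i (j - 1)) / G.kc j) (Wy n)
        - G.ipMT (G.alphaY (Wx n) (Wy n)) (Wy n) - G.ipMT (G.DyC (Z n)) (Wy n)) := by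
    simp only [Grid.ipMT, Finset.mul_sum, ← Finset.sum_add_distrib, ← Finset.sum_sub_distrib]
    refine Finset.sum_congr rfl fun i hi => Finset.sum_congr rfl fun j hj => ?_
    have hstep := (div_eq_iff hΔt.ne').1 (sub_eq_iff_eq_add.1 (sub_eq_iff_eq_add.1
      (eq_sub_of_add_eq (eq_sub_of_add_eq (hmy n hn i hi j hj)))))
    rw [hstep]
    ring
  have hx0 j := (hx n j).1
  have hxN j := (hx n j).2
  have hy0 i := (hy n i).1
  have hyN i := (hy n i).2
  rw [Grid.ipTM_sub_div_hc _ _ hx0 hxN,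
    Grid.ipTM_sub_div_kk _ _ (fun i => (hxg n i).1) (fun i => (hxg n i).2),
    huni.ipTM_alphaX hh.ne' hk.ne' _ _ hx0 hxN hy0 hyN,
    show G.ipTM (G.DxC (Z n)) (Wx n) = _ from Grid.ipTM_sub_div_hc (Z n) _ hx0 hxN] at hmomX
  rw [Grid.ipMT_sub_div_kc _ _ hy0 hyN,
    Grid.ipMT_sub_div_hh _ _ (fun j => (hyg n j).1) (fun j => (hyg n j).2),
    huni.ipMT_alphaY hh.ne' hk.ne' _ _ hx0 hxN hy0 hyN,
    show G.ipMT (G.DyC (Z n)) (Wy n) = _ from Grid.ipMT_sub_div_kc (Z n) _ hy0 hyN] at hmomY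
  have henergy : G.ipTM (fun i j => Wx n i j - Wx (n - 1) i j) (Wx n) +
      G.ipMT (fun i j => Wy n i j - Wy (n - 1) i j) (Wy n) =
        -(Δt * μ * G.DvelNormSq (Wx n) (Wy n)) := by
    rw [hmomX, hmomY, Grid.DvelNormSq]
    linear_combination Δt * hpress
  have hleX := G.ipTM_self_sub_le (Wx (n - 1)) (Wx n)
  have hleY := G.ipMT_self_sub_le (Wy (n - 1)) (Wy n)
  simp only [Grid.velNormSq]
  linarith
end
end

section
/- Consistency of the discrete time derivative of the auxiliary interpolants: let u=(u^x,u^y) ∈ W^{2,∞}([0,T];W^{2,∞}(Ω))². Then there exists a constant C depending only on Ω such that for all n≥1 and all interior indices: |d_tũ^{x,n}_{i,j+1/2} − (1/h_i)∫_{x_{i-1/2}}^{x_{i+1/2}} ∂_t u^x(x,y_{j+1/2},t^n)dx + (γ^{x,n}_{i+1/2,j+1/2}−γ^{x,n}_{i-1/2,j+1/2})/h_i| ≤ C‖u‖_{W^{2,∞}([0,T];W^{2,∞}(Ω))}(h²+k²+Δt), and symmetrically |d_tũ^{y,n}_{i+1/2,j} − (1/k_j)∫_{y_{j-1/2}}^{y_{j+1/2}}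 ∂_t u^y(x_{i+1/2},y,t^n)dy + (γ^{y,n}_{i+1/2,j+1/2}−γ^{y,n}_{i+1/2,j-1/2})/k_j| ≤ C‖u‖_{W^{2,∞}([0,T];W^{2,∞}(Ω))}(h²+k²+Δt). -/
open Finset MeasureTheory Real

noncomputable section

open RMAC

namespace RMAC

/-! ### Partial derivatives of smooth functions -/

/-- The uncurried form of a function of (x, y, t). -/
def uncurried (f : ℝ → ℝ → ℝ → ℝ) (q : ℝ × ℝ × ℝ) : ℝ := f q.1 q.2.1 q.2.2

section PartialDerivatives

variable {f : ℝ → ℝ → ℝ → ℝ}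

theorem smooth_iff : Smooth f ↔ ContDiff ℝ ((⊤ : ℕ∞) : WithTop ℕ∞) (uncurried f) :=
  contDiff_infty.symm

theorem Smooth.differentiable (hf : Smooth f) : Differentiable ℝ (uncurried f) :=
  (hf 1).differentiable (by norm_num)

theorem Smooth.hasDerivAt_x (hf : Smooth f) (x y t : ℝ) :
    HasDerivAt (fun s => f s y t) (fderiv ℝ (uncurried f) (x, y, t) (1, 0, 0)) x :=
  HasFDerivAt.comp_hasDerivAt (l := uncurried f) x (hf.differentiable (x, y, t)).hasFDerivAt
    ((hasDerivAt_id x).prodMk ((hasDerivAt_const x y).prodMk (hasDerivAt_const x t)))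

theorem Smooth.hasDerivAt_y (hf : Smooth f) (x y t : ℝ) :
    HasDerivAt (fun s => f x s t) (fderiv ℝ (uncurried f) (x, y, t) (0, 1, 0)) y :=
  HasFDerivAt.comp_hasDerivAt (l := uncurried f) y (hf.differentiable (x, y, t)).hasFDerivAt
    ((hasDerivAt_const y x).prodMk ((hasDerivAt_id y).prodMk (hasDerivAt_const y t)))

theorem Smooth.hasDerivAt_t (hf : Smooth f) (x y t : ℝ) :
    HasDerivAt (fun s => f x y s) (fderiv ℝ (uncurried f) (x, y, t) (0, 0, 1)) t :=
  HasFDerivAt.comp_hasDerivAt (l := uncurried f) t (hf.differentiable (x, y, t)).hasFDerivAt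
    ((hasDerivAt_const t x).prodMk ((hasDerivAt_const t y).prodMk (hasDerivAt_id t)))

theorem Smooth.uncurried_pdx (hf : Smooth f) :
    uncurried (pdx f) = fun q => fderiv ℝ (uncurried f) q (1, 0, 0) :=
  funext fun q => (hf.hasDerivAt_x q.1 q.2.1 q.2.2).deriv

theorem Smooth.uncurried_pdy (hf : Smooth f) :
    uncurried (pdy f) = fun q => fderiv ℝ (uncurried f) q (0, 1, 0) :=
  funext fun q => (hf.hasDerivAt_y q.1 q.2.1 q.2.2).deriv

theorem Smooth.uncurried_pdt (hf : Smooth f) :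
    uncurried (pdt f) = fun q => fderiv ℝ (uncurried f) q (0, 0, 1) :=
  funext fun q => (hf.hasDerivAt_t q.1 q.2.1 q.2.2).deriv

theorem Smooth.contDiff_fderiv_apply (hf : Smooth f) (v : ℝ × ℝ × ℝ) :
    ContDiff ℝ ((⊤ : ℕ∞) : WithTop ℕ∞) (fun q => fderiv ℝ (uncurried f) q v) :=
  ((smooth_iff.mp hf).fderiv_right (by simp)).clm_apply contDiff_const

theorem Smooth.pdx (hf : Smooth f) : Smooth (pdx f) := by
  rw [smooth_iff, hf.uncurried_pdx]
  exact hf.contDiff_fderiv_apply _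

theorem Smooth.pdy (hf : Smooth f) : Smooth (pdy f) := by
  rw [smooth_iff, hf.uncurried_pdy]
  exact hf.contDiff_fderiv_apply _

theorem Smooth.pdt (hf : Smooth f) : Smooth (pdt f) := by
  rw [smooth_iff, hf.uncurried_pdt]
  exact hf.contDiff_fderiv_apply _

theorem Smooth.fderiv_fderiv_apply_comm (hf : Smooth f) (q v w : ℝ × ℝ × ℝ) :
    fderiv ℝ (fun p => fderiv ℝ (uncurried f) p v) q w =
      fderiv ℝ (fun p => fderiv ℝ (uncurried f) p w) q v := by
  have hd : DifferentiableAt ℝ (fderiv ℝ (uncurried f)) q :=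
    (ContDiff.fderiv_right (m := 1) (hf 2) (by norm_num)).differentiable (by norm_num) q
  have hs : IsSymmSndFDerivAt ℝ (uncurried f) q :=
    (hf 2).contDiffAt.isSymmSndFDerivAt (by simp)
  rw [fderiv_clm_apply hd (differentiableAt_const v),
    fderiv_clm_apply hd (differentiableAt_const w)]
  simpa using hs w v

theorem Smooth.pdx_pdt (hf : Smooth f) : RMAC.pdx (RMAC.pdt f) = RMAC.pdt (RMAC.pdx f) := by
  funext x y t
  have h := hf.fderiv_fderiv_apply_comm (x, y, t) (0, 0, 1) (1, 0, 0)
  rw [← hf.uncurried_pdt, ← hf.uncurried_pdx] at h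
  exact (hf.pdt.hasDerivAt_x x y t).deriv.trans
    (h.trans (hf.pdx.hasDerivAt_t x y t).deriv.symm)

theorem Smooth.pdy_pdt (hf : Smooth f) : RMAC.pdy (RMAC.pdt f) = RMAC.pdt (RMAC.pdy f) := by
  funext x y t
  have h := hf.fderiv_fderiv_apply_comm (x, y, t) (0, 0, 1) (0, 1, 0)
  rw [← hf.uncurried_pdt, ← hf.uncurried_pdy] at h
  exact (hf.pdt.hasDerivAt_y x y t).deriv.trans
    (h.trans (hf.pdy.hasDerivAt_t x y t).deriv.symm)

theorem Smooth.hasDerivAt_pdx (hf : Smooth f) (x y t : ℝ) :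
    HasDerivAt (fun s => f s y t) (RMAC.pdx f x y t) x :=
  (hf.hasDerivAt_x x y t).differentiableAt.hasDerivAt

theorem Smooth.hasDerivAt_pdy (hf : Smooth f) (x y t : ℝ) :
    HasDerivAt (fun s => f x s t) (RMAC.pdy f x y t) y :=
  (hf.hasDerivAt_y x y t).differentiableAt.hasDerivAt

theorem Smooth.hasDerivAt_pdt (hf : Smooth f) (x y t : ℝ) :
    HasDerivAt (fun s => f x y s) (RMAC.pdt f x y t) t :=
  (hf.hasDerivAt_t x y t).differentiableAt.hasDerivAt

/-- Smoothness is preserved when the two space variables are exchanged. -/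
theorem Smooth.swap (hf : Smooth f) : Smooth (fun x y t => f y x t) := fun n =>
  (hf n).comp (contDiff_snd.fst.prodMk (contDiff_fst.prodMk contDiff_snd.snd))

end PartialDerivatives

/-! ### One-dimensional Taylor estimates -/

section Taylor

variable {g g' g'' : ℝ → ℝ} {a b c M : ℝ}

theorem abs_sub_le_of_hasDerivAt (hg : ∀ x, HasDerivAt g (g' x) x)
    (hM : ∀ x ∈ Set.Icc a b, |g' x| ≤ M) {x : ℝ} (hc : c ∈ Set.Icc a b) (hx : x ∈ Set.Icc a b) :
    |g x - g c| ≤ M * |x - c| :=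
  (convex_Icc a b).norm_image_sub_le_of_norm_hasDerivWithin_le
    (fun y _ => (hg y).hasDerivWithinAt) hM hc hx

theorem abs_sub_taylor_le (hg : ∀ x, HasDerivAt g (g' x) x) (hg' : ∀ x, HasDerivAt g' (g'' x) x)
    (hM : ∀ x ∈ Set.Icc a b, |g'' x| ≤ M) {x : ℝ} (hc : c ∈ Set.Icc a b) (hx : x ∈ Set.Icc a b) :
    |g x - g c - g' c * (x - c)| ≤ M * |x - c| ^ 2 := by
  have hsub : Set.uIcc c x ⊆ Set.Icc a b := Set.uIcc_subset_Icc hc hx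
  have hM0 : 0 ≤ M := (abs_nonneg _).trans (hM c hc)
  have hder : ∀ y, HasDerivAt (fun y => g y - g' c * (y - c)) (g' y - g' c) y := fun y => by
    have h := (hg y).sub (((hasDerivAt_id y).sub_const c).const_mul (g' c))
    rwa [mul_one] at h
  have hbd : ∀ y ∈ Set.uIcc c x, |g' y - g' c| ≤ M * |x - c| := fun y hy =>
    (abs_sub_le_of_hasDerivAt hg' hM hc (hsub hy)).trans
      (mul_le_mul_of_nonneg_left (Set.abs_sub_left_of_mem_uIcc hy) hM0)
  have key := abs_sub_le_of_hasDerivAt (a := min c x) (b := max c x) hder hbd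
    Set.left_mem_uIcc Set.right_mem_uIcc
  calc |g x - g c - g' c * (x - c)|
      = |(g x - g' c * (x - c)) - (g c - g' c * (c - c))| := by congr 1; ring
    _ ≤ M * |x - c| * |x - c| := key
    _ = M * |x - c| ^ 2 := by ring

/-- Integrated first-order Taylor expansion around a point `c ∈ [a, b]`. -/
theorem abs_integral_sub_taylor_le (hg : ∀ x, HasDerivAt g (g' x) x)
    (hg' : ∀ x, HasDerivAt g' (g'' x) x) (hM : ∀ x ∈ Set.Icc a b, |g'' x| ≤ M)
    (hc : c ∈ Set.Icc a b) {r : ℝ} (hra : c - a ≤ r) (hrb : b - c ≤ r) :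
    |(∫ x in a..b, g x) - (b - a) * g c - g' c * (((b - c) ^ 2 - (c - a) ^ 2) / 2)| ≤
      M * r ^ 2 * (b - a) := by
  have hab : a ≤ b := hc.1.trans hc.2
  have hM0 : 0 ≤ M := (abs_nonneg _).trans (hM c hc)
  have hgc : Continuous g := continuous_iff_continuousAt.mpr fun x => (hg x).continuousAt
  have hlin : (∫ x in a..b, g' c * (x - c)) = g' c * (((b - c) ^ 2 - (c - a) ^ 2) / 2) := by
    rw [intervalIntegral.integral_const_mul, intervalIntegral.integral_sub
      intervalIntegral.intervalIntegrable_id intervalIntegrable_const, integral_id,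
      intervalIntegral.integral_const, smul_eq_mul]
    ring
  have heq : (∫ x in a..b, (g x - g c - g' c * (x - c))) =
      (∫ x in a..b, g x) - (b - a) * g c - g' c * (((b - c) ^ 2 - (c - a) ^ 2) / 2) := by
    rw [intervalIntegral.integral_sub, intervalIntegral.integral_sub, hlin,
      intervalIntegral.integral_const, smul_eq_mul] <;>
      exact Continuous.intervalIntegrable (by fun_prop) _ _
  rw [← heq]
  have h := intervalIntegral.norm_integral_le_of_norm_le_const (a := a) (b := b)
    (C := M * r ^ 2) (f := fun x => g x - g c - g' c * (x - c)) fun x hx => by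
      rw [Set.uIoc_of_le hab] at hx
      have hr : |x - c| ≤ r := abs_le.mpr ⟨by linarith [hx.1], by linarith [hx.2]⟩
      refine (abs_sub_taylor_le hg hg' hM hc ⟨hx.1.le, hx.2⟩).trans ?_
      gcongr
  rwa [abs_of_nonneg (sub_nonneg.mpr hab)] at h

end Taylor

/-! ### Consistency on a single patch of the grid -/

/-- Combination of the time, transverse and longitudinal error bounds on a patch with time step
`δ`, transverse width `k` and longitudinal widths `p`, `q`. -/
theorem abs_consistency_le {M H K δ k p q It Is J X Yt Ys F G G₀ G₁ : ℝ} (hM : 0 ≤ M)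
    (hδ : 0 < δ) (hk : 0 < k) (hp : 0 < p) (hq : 0 < q) (hpH : p ≤ H) (hqH : q ≤ H) (hkK : k ≤ K)
    (htime : |(It - Is) - δ * J| ≤ M * δ ^ 2 * k)
    (hyavg : |J - k * F| ≤ M * (k / 2) ^ 2 * k)
    (hyy : |Yt - Ys| ≤ M * δ)
    (hxavg : |X - (p + q) / 2 * F - G * (((q / 2) ^ 2 - (p / 2) ^ 2) / 2)| ≤
      M * (H / 2) ^ 2 * ((p + q) / 2))
    (hγ₁ : |G₁ - G| ≤ M * (q / 2)) (hγ₀ : |G₀ - G| ≤ M * (p / 2)) :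
    |((1 / k * It - k ^ 2 / 6 * Yt) - (1 / k * Is - k ^ 2 / 6 * Ys)) / δ
      - 1 / ((p + q) / 2) * X + (q ^ 2 / 8 * G₁ - p ^ 2 / 8 * G₀) / ((p + q) / 2)| ≤
      M * (H ^ 2 + K ^ 2 + δ) := by
  have hc : 0 < (p + q) / 2 := by positivity
  have hMk : M * k ^ 2 ≤ M * K ^ 2 := by gcongr
  have hMH : 0 ≤ M * H ^ 2 := by positivity
  have hdecomp : ((1 / k * It - k ^ 2 / 6 * Yt) - (1 / k * Is - k ^ 2 / 6 * Ys)) / δ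
      - 1 / ((p + q) / 2) * X + (q ^ 2 / 8 * G₁ - p ^ 2 / 8 * G₀) / ((p + q) / 2) =
      ((It - Is) - δ * J) / (δ * k) + (J - k * F) / k - k ^ 2 / 6 * ((Yt - Ys) / δ)
      - (X - (p + q) / 2 * F - G * (((q / 2) ^ 2 - (p / 2) ^ 2) / 2)) / ((p + q) / 2)
      + (q ^ 2 / 8 * (G₁ - G) - p ^ 2 / 8 * (G₀ - G)) / ((p + q) / 2) := by
    field_simp
    ring
  have h₁ : |((It - Is) - δ * J) / (δ * k)| ≤ M * δ := by
    rw [abs_div, abs_of_pos (mul_pos hδ hk), div_le_iff₀ (mul_pos hδ hk)]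
    exact htime.trans_eq (by ring)
  have h₂ : |(J - k * F) / k| ≤ M * k ^ 2 / 4 := by
    rw [abs_div, abs_of_pos hk, div_le_iff₀ hk]
    exact hyavg.trans_eq (by ring)
  have h₃ : |k ^ 2 / 6 * ((Yt - Ys) / δ)| ≤ M * k ^ 2 / 6 := by
    have h : |(Yt - Ys) / δ| ≤ M := by
      rwa [abs_div, abs_of_pos hδ, div_le_iff₀ hδ]
    rw [abs_mul, abs_of_pos (by positivity)]
    calc k ^ 2 / 6 * |(Yt - Ys) / δ| ≤ k ^ 2 / 6 * M := by gcongr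
      _ = M * k ^ 2 / 6 := by ring
  have h₄ : |(X - (p + q) / 2 * F - G * (((q / 2) ^ 2 - (p / 2) ^ 2) / 2)) / ((p + q) / 2)| ≤
      M * H ^ 2 / 4 := by
    rw [abs_div, abs_of_pos hc, div_le_iff₀ hc]
    exact hxavg.trans_eq (by ring)
  have h₅ : |(q ^ 2 / 8 * (G₁ - G) - p ^ 2 / 8 * (G₀ - G)) / ((p + q) / 2)| ≤
      M * H ^ 2 / 8 := by
    rw [abs_div, abs_of_pos hc, div_le_iff₀ hc]
    refine (abs_sub _ _).trans ?_
    rw [abs_mul, abs_mul, abs_of_pos (by positivity : 0 < q ^ 2 / 8),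
      abs_of_pos (by positivity : 0 < p ^ 2 / 8)]
    calc q ^ 2 / 8 * |G₁ - G| + p ^ 2 / 8 * |G₀ - G|
        ≤ H ^ 2 / 8 * (M * (q / 2)) + H ^ 2 / 8 * (M * (p / 2)) := by gcongr
      _ = M * H ^ 2 / 8 * ((p + q) / 2) := by ring
  rw [hdecomp]
  rw [abs_le] at *
  constructor <;> linarith [h₁.1, h₁.2, h₂.1, h₂.2, h₃.1, h₃.2, h₄.1, h₄.2, h₅.1, h₅.2]

/-- The consistency estimate for a smooth function on `[x₀, x₂] × [y₀, y₁] × [s, t]`, with `x₁`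
an interior node of `[x₀, x₂]`. -/
theorem patch_consistency {f : ℝ → ℝ → ℝ → ℝ} (hf : Smooth f) {x₀ x₁ x₂ y₀ y₁ s t M H K : ℝ}
    (hx₀ : x₀ < x₁) (hx₁ : x₁ < x₂) (hy : y₀ < y₁) (hst : s < t)
    (hH₀ : x₁ - x₀ ≤ H) (hH₁ : x₂ - x₁ ≤ H) (hK : y₁ - y₀ ≤ K)
    (htt : ∀ x ∈ Set.Icc x₀ x₂, ∀ y ∈ Set.Icc y₀ y₁, ∀ τ ∈ Set.Icc s t,
      |pdt (pdt f) x y τ| ≤ M)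
    (htxx : ∀ x ∈ Set.Icc x₀ x₂, ∀ y ∈ Set.Icc y₀ y₁, ∀ τ ∈ Set.Icc s t,
      |pdt (pdx (pdx f)) x y τ| ≤ M)
    (htyy : ∀ x ∈ Set.Icc x₀ x₂, ∀ y ∈ Set.Icc y₀ y₁, ∀ τ ∈ Set.Icc s t,
      |pdt (pdy (pdy f)) x y τ| ≤ M) :
    |((1 / (y₁ - y₀) * (∫ y in y₀..y₁, f x₁ y t)
          - (y₁ - y₀) ^ 2 / 6 * pdy (pdy f) x₁ ((y₀ + y₁) / 2) t)
        - (1 / (y₁ - y₀) * (∫ y in y₀..y₁, f x₁ y s)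
          - (y₁ - y₀) ^ 2 / 6 * pdy (pdy f) x₁ ((y₀ + y₁) / 2) s)) / (t - s)
      - 1 / ((x₁ - x₀ + (x₂ - x₁)) / 2) *
          (∫ x in ((x₀ + x₁) / 2)..((x₁ + x₂) / 2), pdt f x ((y₀ + y₁) / 2) t)
      + ((x₂ - x₁) ^ 2 / 8 * pdt (pdx f) ((x₁ + x₂) / 2) ((y₀ + y₁) / 2) t
        - (x₁ - x₀) ^ 2 / 8 * pdt (pdx f) ((x₀ + x₁) / 2) ((y₀ + y₁) / 2) t)
          / ((x₁ - x₀ + (x₂ - x₁)) / 2)| ≤ M * (H ^ 2 + K ^ 2 + (t - s)) := by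
  have hx₁mem : x₁ ∈ Set.Icc x₀ x₂ := ⟨hx₀.le, hx₁.le⟩
  have hym : (y₀ + y₁) / 2 ∈ Set.Icc y₀ y₁ := ⟨by linarith, by linarith⟩
  have hs : s ∈ Set.Icc s t := Set.left_mem_Icc.mpr hst.le
  have ht : t ∈ Set.Icc s t := Set.right_mem_Icc.mpr hst.le
  have hM0 : 0 ≤ M := (abs_nonneg _).trans (htt x₁ hx₁mem _ hym t ht)
  have htime : |((∫ y in y₀..y₁, f x₁ y t) - ∫ y in y₀..y₁, f x₁ y s)
      - (t - s) * ∫ y in y₀..y₁, pdt f x₁ y t| ≤ M * (t - s) ^ 2 * (y₁ - y₀) := by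
    have hc : ∀ {u : ℝ → ℝ → ℝ → ℝ}, Smooth u → ∀ τ, Continuous fun y => u x₁ y τ :=
      fun hu τ => continuous_iff_continuousAt.mpr fun y => (hu.hasDerivAt_y x₁ y τ).continuousAt
    have hct := hc hf t
    have hcs := hc hf s
    have hcd := hc hf.pdt t
    have heq : (∫ y in y₀..y₁, (f x₁ y t - f x₁ y s - (t - s) * pdt f x₁ y t)) =
        ((∫ y in y₀..y₁, f x₁ y t) - ∫ y in y₀..y₁, f x₁ y s)
          - (t - s) * ∫ y in y₀..y₁, pdt f x₁ y t := by
      rw [intervalIntegral.integral_sub, intervalIntegral.integral_sub,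
        intervalIntegral.integral_const_mul] <;>
        exact Continuous.intervalIntegrable (by fun_prop) _ _
    rw [← heq, ← abs_of_pos (sub_pos.mpr hy)]
    refine intervalIntegral.norm_integral_le_of_norm_le_const (E := ℝ) fun y hy' => ?_
    rw [Set.uIoc_of_le hy.le] at hy'
    have h := abs_sub_taylor_le (hf.hasDerivAt_pdt x₁ y) (hf.pdt.hasDerivAt_pdt x₁ y)
      (htt x₁ hx₁mem y ⟨hy'.1.le, hy'.2⟩) ht hs
    rw [abs_sub_comm s t, abs_of_pos (sub_pos.mpr hst)] at h
    rw [Real.norm_eq_abs, ← abs_neg]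
    convert h using 2
    ring
  have hyavg : |(∫ y in y₀..y₁, pdt f x₁ y t) - (y₁ - y₀) * pdt f x₁ ((y₀ + y₁) / 2) t| ≤
      M * ((y₁ - y₀) / 2) ^ 2 * (y₁ - y₀) := by
    have h := abs_integral_sub_taylor_le (a := y₀) (b := y₁) (M := M) (r := (y₁ - y₀) / 2)
      (fun y => hf.pdt.hasDerivAt_pdy x₁ y t) (fun y => hf.pdt.pdy.hasDerivAt_pdy x₁ y t)
      (fun y hy' => by
        rw [hf.pdy_pdt, hf.pdy.pdy_pdt]
        exact htyy x₁ hx₁mem y hy' t ht) hym (by linarith) (by linarith)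
    convert h using 2
    ring
  have hyy : |pdy (pdy f) x₁ ((y₀ + y₁) / 2) t - pdy (pdy f) x₁ ((y₀ + y₁) / 2) s| ≤
      M * (t - s) := by
    have h := abs_sub_le_of_hasDerivAt (hf.pdy.pdy.hasDerivAt_pdt x₁ ((y₀ + y₁) / 2))
      (htyy x₁ hx₁mem _ hym) hs ht
    rwa [abs_of_pos (sub_pos.mpr hst)] at h
  have hxx : ∀ x ∈ Set.Icc x₀ x₂, |pdx (pdt (pdx f)) x ((y₀ + y₁) / 2) t| ≤ M := fun x hx => by
    rw [hf.pdx.pdx_pdt]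
    exact htxx x hx _ hym t ht
  have hxavg := abs_integral_sub_taylor_le (a := (x₀ + x₁) / 2) (b := (x₁ + x₂) / 2) (c := x₁)
    (M := M) (r := H / 2)
    (fun x => hf.pdx_pdt ▸ hf.pdt.hasDerivAt_pdx x ((y₀ + y₁) / 2) t)
    (fun x => hf.pdx.pdt.hasDerivAt_pdx x ((y₀ + y₁) / 2) t)
    (fun x hx => hxx x ⟨by linarith [hx.1], by linarith [hx.2]⟩)
    ⟨by linarith, by linarith⟩ (by linarith) (by linarith)
  have hγ₁ := abs_sub_le_of_hasDerivAt (fun x => hf.pdx.pdt.hasDerivAt_pdx x ((y₀ + y₁) / 2) t)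
    hxx hx₁mem (x := (x₁ + x₂) / 2) ⟨by linarith, by linarith⟩
  have hγ₀ := abs_sub_le_of_hasDerivAt (fun x => hf.pdx.pdt.hasDerivAt_pdx x ((y₀ + y₁) / 2) t)
    hxx hx₁mem (x := (x₀ + x₁) / 2) ⟨by linarith, by linarith⟩
  rw [abs_of_pos (a := (x₁ + x₂) / 2 - x₁) (by linarith)] at hγ₁
  rw [abs_of_neg (a := (x₀ + x₁) / 2 - x₁) (by linarith)] at hγ₀
  refine abs_consistency_le hM0 (sub_pos.mpr hst) (sub_pos.mpr hy) (sub_pos.mpr hx₀)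
    (sub_pos.mpr hx₁) hH₀ hH₁ hK htime hyavg hyy (F := pdt f x₁ ((y₀ + y₁) / 2) t)
    (G := pdt (pdx f) x₁ ((y₀ + y₁) / 2) t) ?_ ?_ ?_
  · convert hxavg using 2 <;> ring
  · convert hγ₁ using 2; ring
  · convert hγ₀ using 2; ring

/-! ### Elementary grid facts -/

theorem monotone_nodes {p : ℤ → ℝ} {N : ℕ} (hp : ∀ i : ℤ, 0 ≤ i → i < N → p i < p (i + 1))
    {a b : ℤ} (ha : 0 ≤ a) (hab : a ≤ b) (hb : b ≤ N) : p a ≤ p b := by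
  induction b, hab using Int.leInduction with
  | base => exact le_rfl
  | succ b hab ih => exact (ih (by omega)).trans (hp b (by omega) (by omega)).le

namespace Grid

variable (G : Grid)

theorem xp_mem_Icc {i : ℤ} (h0 : 0 ≤ i) (hi : i ≤ G.Nx) : G.xp i ∈ Set.Icc 0 G.Lx := by
  rw [← G.xp_zero, ← G.xp_last]
  exact ⟨monotone_nodes G.xp_mono le_rfl h0 hi, monotone_nodes G.xp_mono h0 hi le_rfl⟩

theorem yp_mem_Icc {j : ℤ} (h0 : 0 ≤ j) (hj : j ≤ G.Ny) : G.yp j ∈ Set.Icc 0 G.Ly := by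
  rw [← G.yp_zero, ← G.yp_last]
  exact ⟨monotone_nodes G.yp_mono le_rfl h0 hj, monotone_nodes G.yp_mono h0 hj le_rfl⟩

theorem hh_le_hmax {i : ℤ} (h0 : 0 ≤ i) (hi : i < G.Nx) : G.hh i ≤ G.hmax :=
  Finset.le_sup' G.hh (Finset.mem_Icc.mpr ⟨h0, by omega⟩)

theorem kk_le_kmax {j : ℤ} (h0 : 0 ≤ j) (hj : j < G.Ny) : G.kk j ≤ G.kmax :=
  Finset.le_sup' G.kk (Finset.mem_Icc.mpr ⟨h0, by omega⟩)

/-- The x-component estimate on the whole grid, from bounds on the three derivatives it uses. -/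
theorem tux_consistency {f : ℝ → ℝ → ℝ → ℝ} (hf : Smooth f) {Δt T M : ℝ} (hΔt : 0 < Δt)
    {n : ℕ} (hn : 1 ≤ n) (hnT : n * Δt ≤ T)
    (htt : ∀ x ∈ Set.Icc 0 G.Lx, ∀ y ∈ Set.Icc 0 G.Ly, ∀ τ ∈ Set.Icc 0 T,
      |pdt (pdt f) x y τ| ≤ M)
    (htxx : ∀ x ∈ Set.Icc 0 G.Lx, ∀ y ∈ Set.Icc 0 G.Ly, ∀ τ ∈ Set.Icc 0 T,
      |pdt (pdx (pdx f)) x y τ| ≤ M)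
    (htyy : ∀ x ∈ Set.Icc 0 G.Lx, ∀ y ∈ Set.Icc 0 G.Ly, ∀ τ ∈ Set.Icc 0 T,
      |pdt (pdy (pdy f)) x y τ| ≤ M)
    {i j : ℤ} (hi : i ∈ Finset.Icc (1 : ℤ) ((G.Nx : ℤ) - 1))
    (hj : j ∈ Finset.Icc (0 : ℤ) ((G.Ny : ℤ) - 1)) :
    |(G.tux f Δt n i j - G.tux f Δt (n - 1) i j) / Δt
        - (1 / G.hc i) * (∫ x in (G.xh (i - 1))..(G.xh i), pdt f x (G.yh j) ((n : ℝ) * Δt))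
        + (G.gammax f Δt n i j - G.gammax f Δt n (i - 1) j) / G.hc i| ≤
      M * (G.hmax ^ 2 + G.kmax ^ 2 + Δt) := by
  rw [Finset.mem_Icc] at hi hj
  have hs0 : 0 ≤ ((n - 1 : ℕ) : ℝ) * Δt := by positivity
  have hδ : (n : ℝ) * Δt - ((n - 1 : ℕ) : ℝ) * Δt = Δt := by
    rw [Nat.cast_pred hn]
    ring
  have hx₀ := G.xp_mono (i - 1) (by omega) (by omega)
  have hH₀ := G.hh_le_hmax (i := i - 1) (by omega) (by omega)
  simp only [hh, sub_add_cancel] at hx₀ hH₀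
  have hx : Set.Icc (G.xp (i - 1)) (G.xp (i + 1)) ⊆ Set.Icc 0 G.Lx :=
    Set.Icc_subset_Icc (G.xp_mem_Icc (by omega) (by omega)).1
      (G.xp_mem_Icc (by omega) (by omega)).2
  have hy : Set.Icc (G.yp j) (G.yp (j + 1)) ⊆ Set.Icc 0 G.Ly :=
    Set.Icc_subset_Icc (G.yp_mem_Icc (by omega) (by omega)).1
      (G.yp_mem_Icc (by omega) (by omega)).2
  have ht : Set.Icc (((n - 1 : ℕ) : ℝ) * Δt) (n * Δt) ⊆ Set.Icc 0 T :=
    Set.Icc_subset_Icc hs0 hnT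
  have key := patch_consistency hf hx₀ (G.xp_mono i (by omega) (by omega))
    (G.yp_mono j (by omega) (by omega)) (sub_pos.mp (hΔt.trans_eq hδ.symm)) hH₀
    (G.hh_le_hmax (by omega) (by omega)) (G.kk_le_kmax (by omega) (by omega))
    (fun x hx' y hy' τ hτ => htt x (hx hx') y (hy hy') τ (ht hτ))
    (fun x hx' y hy' τ hτ => htxx x (hx hx') y (hy hy') τ (ht hτ))
    (fun x hx' y hy' τ hτ => htyy x (hx hx') y (hy hy') τ (ht hτ))
  rw [hδ] at key
  have hj₁ : j ≠ -1 := by omega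
  have hj₂ : j ≠ (G.Ny : ℤ) := by omega
  have hi₁ : i ≠ 0 := by omega
  have hi₂ : i ≠ (G.Nx : ℤ) := by omega
  simpa only [tux, gammax, hc, hh, kk, xh, yh, hj₁, hj₂, hi₁, hi₂, if_false, sub_add_cancel]
    using key

/-- The grid with the two space directions exchanged. -/
def swap : Grid where
  Nx := G.Ny
  Ny := G.Nx
  Lx := G.Ly
  Ly := G.Lx
  xp := G.yp
  yp := G.xp
  one_le_Nx := G.one_le_Ny
  one_le_Ny := G.one_le_Nx
  xp_zero := G.yp_zero
  xp_last := G.yp_last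
  yp_zero := G.xp_zero
  yp_last := G.xp_last
  xp_mono := G.yp_mono
  yp_mono := G.xp_mono

end Grid

end RMAC

/-- consistency of the discrete time derivative of the auxiliary
interpolants. `d_t ũ^{x,n}` equals the cell average of `∂_t u^x` minus the difference
quotient of the `γ^x` terms, up to `O(‖u‖_{W^{2,∞}W^{2,∞}}(h²+k²+Δt))`, and symmetrically in
the y-direction. -/
theorem dt_interpolant_consistency (Lx Ly : ℝ) (hLx : 0 < Lx) (hLy : 0 < Ly) :
    ∃ C : ℝ, 0 < C ∧
      ∀ T : ℝ, 0 < T → ∀ N : ℕ, 1 ≤ N → ∀ Δt : ℝ, Δt = T / N →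
      ∀ G : RMAC.Grid, G.Lx = Lx → G.Ly = Ly →
      ∀ ux uy : ℝ → ℝ → ℝ → ℝ, RMAC.Smooth ux → RMAC.Smooth uy →
      ∀ M : ℝ, RMAC.SobBound 2 2 ux Lx Ly T M → RMAC.SobBound 2 2 uy Lx Ly T M →
      ∀ n : ℕ, 1 ≤ n → n ≤ N →
        (∀ i ∈ Finset.Icc (1 : ℤ) ((G.Nx : ℤ) - 1),
          ∀ j ∈ Finset.Icc (0 : ℤ) ((G.Ny : ℤ) - 1),
            |(G.tux ux Δt n i j - G.tux ux Δt (n - 1) i j) / Δt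
                - (1 / G.hc i) *
                    (∫ x in (G.xh (i - 1))..(G.xh i), RMAC.pdt ux x (G.yh j) ((n : ℝ) * Δt))
                + (G.gammax ux Δt n i j - G.gammax ux Δt n (i - 1) j) / G.hc i| ≤
              C * M * (G.hmax ^ 2 + G.kmax ^ 2 + Δt)) ∧
        (∀ i ∈ Finset.Icc (0 : ℤ) ((G.Nx : ℤ) - 1),
          ∀ j ∈ Finset.Icc (1 : ℤ) ((G.Ny : ℤ) - 1),
            |(G.tuy uy Δt n i j - G.tuy uy Δt (n - 1) i j) / Δt
                - (1 / G.kc j) *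
                    (∫ y in (G.yh (j - 1))..(G.yh j), RMAC.pdt uy (G.xh i) y ((n : ℝ) * Δt))
                + (G.gammay uy Δt n i j - G.gammay uy Δt n i (j - 1)) / G.kc j| ≤
              C * M * (G.hmax ^ 2 + G.kmax ^ 2 + Δt)) := by
  refine ⟨1, one_pos, ?_⟩
  intro T hT N hN Δt hΔt G hGx hGy ux uy hux huy M hMx hMy n hn hnN
  subst hGx hGy
  have hN0 : (0 : ℝ) < N := by exact_mod_cast hN
  have hΔ0 : 0 < Δt := hΔt ▸ div_pos hT hN0
  have hnT : (n : ℝ) * Δt ≤ T := by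
    calc (n : ℝ) * Δt ≤ N * Δt := by gcongr
      _ = T := by rw [hΔt]; field_simp
  rw [one_mul]
  refine ⟨fun i hi j hj => G.tux_consistency hux hΔ0 hn hnT ?_ ?_ ?_ hi hj, fun i hi j hj => ?_⟩
  · exact fun x hx y hy τ hτ => hMx 2 0 0 le_rfl (by norm_num) x y τ hx hy hτ
  · exact fun x hx y hy τ hτ => hMx 1 2 0 (by norm_num) le_rfl x y τ hx hy hτ
  · exact fun x hx y hy τ hτ => hMx 1 0 2 (by norm_num) le_rfl x y τ hx hy hτ
  · rw [add_comm (G.hmax ^ 2)]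
    refine G.swap.tux_consistency huy.swap hΔ0 hn hnT ?_ ?_ ?_ hj hi
    · exact fun y hy x hx τ hτ => hMy 2 0 0 le_rfl (by norm_num) x y τ hx hy hτ
    · exact fun y hy x hx τ hτ => hMy 1 0 2 (by norm_num) le_rfl x y τ hx hy hτ
    · exact fun y hy x hx τ hτ => hMy 1 2 0 (by norm_num) le_rfl x y τ hx hy hτ
end
end
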